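/- arXiv:1406.3745 — 2 statements merged into one kernel-verified Lean document; each statement's English description precedes it below -/
import Mathlib

section
/- Let (b_k)_{k≥1} be a sequence of pairwise coprime integers with b_k ≥ 2 and ∑_{k≥1} 1/b_k < ∞. Let c ∈ ℕ be coprime to every b_k, and let r ∈ ℕ. Then the natural density of the set {s ∈ ℕ : s·c + r ≢ 0 (mod b_k) for every k ≥ 1} exists and equals ∏_{k≥1}(1 − 1/b_k). -/
open scoped Classical

lemma aux_prog (b c r N : ℕ) (hb : 2 ≤ b) (hc : Nat.Coprime c b) :
    ∃ s0 T : ℕ, |(T : ℝ) - N / b| ≤ 1 ∧ ∀ Q : ℕ → Prop,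
      ((Finset.range N).filter (fun s => b ∣ s * c + r ∧ Q s)).card =
      ((Finset.range T).filter (fun t => Q (s0 + b * t))).card := by
  have hb0 : 0 < b := by omega
  have : NeZero b := ⟨by omega⟩
  -- the residue solving the congruence
  obtain ⟨s0, hs0, hdiv⟩ : ∃ s0, s0 < b ∧ ∀ s, b ∣ s * c + r ↔ s % b = s0 := by
    let u := ZMod.unitOfCoprime c hc
    let z : ZMod b := -(r : ZMod b) * ((u⁻¹ : (ZMod b)ˣ) : ZMod b)
    refine ⟨z.val, ZMod.val_lt z, fun s => ?_⟩
    have hu : (u : ZMod b) = (c : ZMod b) := rfl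
    have h1 : b ∣ s * c + r ↔ ((s : ZMod b)) = z := by
      rw [← ZMod.natCast_eq_zero_iff]
      push_cast
      rw [← hu, Units.eq_mul_inv_iff_mul_eq, eq_neg_iff_add_eq_zero]
    rw [h1, ← ZMod.val_natCast]
    exact ⟨fun h => by rw [h], fun h => ZMod.val_injective b h⟩
  refine ⟨s0, (N + (b - 1 - s0)) / b, ?_, fun Q => ?_⟩
  · have hbR : (0 : ℝ) < b := by exact_mod_cast hb0
    have e := Nat.div_add_mod (N + (b - 1 - s0)) b
    have l := Nat.mod_lt (N + (b - 1 - s0)) hb0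
    set T := (N + (b - 1 - s0)) / b
    have u1 : b * T ≤ N + b := by omega
    have u2 : N ≤ b * T + b := by omega
    have u1R : (b : ℝ) * T ≤ N + b := by exact_mod_cast u1
    have u2R : (N : ℝ) ≤ b * T + b := by exact_mod_cast u2
    have h3 : (T : ℝ) - N / b = (b * T - N) / b := by field_simp
    rw [h3, abs_le]
    constructor
    · rw [le_div_iff₀ hbR]; linarith
    · rw [div_le_iff₀ hbR]; linarith
  · symm
    apply Finset.card_bij (fun t _ => s0 + b * t)
    · intro t ht
      simp only [Finset.mem_filter, Finset.mem_range] at ht ⊢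
      obtain ⟨ht, hq⟩ := ht
      rw [Nat.lt_iff_add_one_le, Nat.le_div_iff_mul_le hb0] at ht
      refine ⟨?_, (hdiv _).2 ?_, hq⟩
      · have : (t + 1) * b = b * t + b := by ring
        omega
      · rw [Nat.add_mul_mod_self_left, Nat.mod_eq_of_lt hs0]
    · intro a _ a' _ h
      exact Nat.eq_of_mul_eq_mul_left hb0 (Nat.add_left_cancel h)
    · intro s hs
      simp only [Finset.mem_filter, Finset.mem_range] at hs
      obtain ⟨hN, hd, hq⟩ := hs
      have hm := (hdiv s).1 hd
      have e : s0 + b * (s / b) = s := by rw [← hm]; exact Nat.mod_add_div s b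
      refine ⟨s / b, ?_, e⟩
      simp only [Finset.mem_filter, Finset.mem_range]
      rw [e]
      refine ⟨?_, hq⟩
      rw [Nat.lt_iff_add_one_le, Nat.le_div_iff_mul_le hb0]
      have : (s / b + 1) * b = b * (s / b) + b := by ring
      omega

lemma aux_fin (b : ℕ → ℕ) (hb : ∀ k, 2 ≤ b k)
    (hcop : ∀ i j, i ≠ j → Nat.Coprime (b i) (b j)) (K : ℕ) :
    ∀ c r N : ℕ, (∀ k, K ≤ k ∨ Nat.Coprime c (b k)) →
    |(((Finset.range N).filter (fun s => ∀ k < K, ¬ b k ∣ s * c + r)).card : ℝ)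
      - N * ∏ k ∈ Finset.range K, (1 - 1 / (b k : ℝ))| ≤ 3 ^ K := by
  induction K with
  | zero => intro c r N _; simp
  | succ K ih =>
    intro c r N hc
    have hcK : Nat.Coprime c (b K) := (hc K).resolve_left (by omega)
    obtain ⟨s0, T, hT, hQ⟩ := aux_prog (b K) c r N (hb K) hcK
    have h1 := ih c r N (fun k => by
      rcases hc k with h | h
      · left; omega
      · right; exact h)
    have h2 := ih (b K * c) (s0 * c + r) T (fun k => by
      by_cases hk : K ≤ k
      · left; exact hk
      · right
        exact Nat.Coprime.mul_left (hcop K k (by omega)) ((hc k).resolve_left (by omega)))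
    have h3 : ((Finset.range N).filter
        (fun s => b K ∣ s * c + r ∧ ∀ k < K, ¬ b k ∣ s * c + r)).card =
        ((Finset.range T).filter
        (fun t => ∀ k < K, ¬ b k ∣ (s0 + b K * t) * c + r)).card := by
      convert hQ (fun s => ∀ k < K, ¬ b k ∣ s * c + r)
    have h4 : ((Finset.range T).filter
        (fun t => ∀ k < K, ¬ b k ∣ (s0 + b K * t) * c + r)) =
        ((Finset.range T).filter
        (fun t => ∀ k < K, ¬ b k ∣ t * (b K * c) + (s0 * c + r))) := by
      apply Finset.filter_congr
      intro t _
      have : (s0 + b K * t) * c + r = t * (b K * c) + (s0 * c + r) := by ring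
      rw [this]
    rw [h4] at h3
    have h5 : ((Finset.range N).filter (fun s => ∀ k < K, ¬ b k ∣ s * c + r)).card =
        ((Finset.range N).filter (fun s => b K ∣ s * c + r ∧ ∀ k < K, ¬ b k ∣ s * c + r)).card
        + ((Finset.range N).filter (fun s => ∀ k < K + 1, ¬ b k ∣ s * c + r)).card := by
      rw [← Finset.card_union_of_disjoint]
      · congr 1
        ext s
        simp only [Finset.mem_filter, Finset.mem_union, Finset.mem_range, Nat.forall_lt_succ_right]
        tauto
      · rw [Finset.disjoint_left]
        intro s h h'
        simp only [Finset.mem_filter] at h h'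
        exact h'.2 K (by omega) h.2.1
    rw [h3] at h5
    have h5R : (((Finset.range N).filter (fun s => ∀ k < K, ¬ b k ∣ s * c + r)).card : ℝ) = _ :=
      congrArg (Nat.cast) h5
    rw [Nat.cast_add] at h5R
    rw [Finset.prod_range_succ]
    have hP : |∏ k ∈ Finset.range K, (1 - 1 / (b k : ℝ))| ≤ 1 := by
      rw [Finset.abs_prod]
      apply Finset.prod_le_one
      · intros; positivity
      · intro k _
        have : (2 : ℝ) ≤ b k := by exact_mod_cast hb k
        have h0 : 0 < 1 / (b k : ℝ) := by positivity
        have h1 : 1 / (b k : ℝ) ≤ 1 := by rw [div_le_one (by linarith)]; linarith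
        rw [abs_le]; constructor <;> linarith
    set P := ∏ k ∈ Finset.range K, (1 - 1 / (b k : ℝ))
    have h6 : |((T : ℝ) - N / b K) * P| ≤ 1 := by
      rw [abs_mul]
      exact mul_le_one₀ hT (abs_nonneg _) hP
    have h7 : (N : ℝ) * (P * (1 - 1 / (b K : ℝ))) = N * P - N / b K * P := by ring
    have h8 : (1 : ℝ) ≤ 3 ^ K := one_le_pow₀ (by norm_num)
    rw [h7, pow_succ]
    rw [sub_mul] at h6
    rw [abs_le] at *
    constructor <;> linarith [h1.1, h1.2, h2.1, h2.2, h6.1, h6.2]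

lemma aux_tail (b : ℕ → ℕ) (hb : ∀ k, 2 ≤ b k)
    (hsum : Summable (fun k => (1 : ℝ) / b k))
    (c r : ℕ) (hr : 0 < r) (hc : ∀ k, Nat.Coprime c (b k)) (N : ℕ) :
    (((Finset.range N).filter (fun s => ∃ k, b k ∣ s * c + r)).card : ℝ) ≤
      (N + (N * c + r)) * ∑' k, (1 : ℝ) / b k := by
  have hX : (0 : ℝ) < ((N * c + r : ℕ) : ℝ) := by exact_mod_cast (by omega)
  have hbpos : ∀ k, (0 : ℝ) < b k := fun k => by
    have := hb k
    exact_mod_cast (by omega : 0 < b k)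
  have hfin : {k | b k ≤ N * c + r}.Finite := by
    have h := hsum.tendsto_cofinite_zero
    have h2 := h.eventually_lt_const (u := 1 / ((N * c + r : ℕ) : ℝ)) (by positivity)
    rw [Filter.eventually_cofinite] at h2
    refine h2.subset ?_
    intro k hk
    simp only [Set.mem_ofPred_eq, not_lt] at hk ⊢
    exact one_div_le_one_div_of_le (hbpos k) (by exact_mod_cast hk)
  have hsub : (Finset.range N).filter (fun s => ∃ k, b k ∣ s * c + r) ⊆
      hfin.toFinset.biUnion (fun k => (Finset.range N).filter (fun s => b k ∣ s * c + r)) := by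
    intro s hs
    simp only [Finset.mem_filter, Finset.mem_range, Finset.mem_biUnion, Set.Finite.mem_toFinset,
      Set.mem_ofPred_eq] at hs ⊢
    obtain ⟨hN, k, hk⟩ := hs
    refine ⟨k, ?_, hN, hk⟩
    have := Nat.le_of_dvd (by omega) hk
    have := Nat.mul_le_mul_right c hN.le
    omega
  have h1 := (Finset.card_le_card hsub).trans Finset.card_biUnion_le
  calc (((Finset.range N).filter (fun s => ∃ k, b k ∣ s * c + r)).card : ℝ)
      ≤ ∑ k ∈ hfin.toFinset,
          (((Finset.range N).filter (fun s => b k ∣ s * c + r)).card : ℝ) := by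
        exact_mod_cast h1
    _ ≤ ∑ k ∈ hfin.toFinset, ((N : ℝ) + (N * c + r)) * (1 / b k) := by
        apply Finset.sum_le_sum
        intro k hk
        simp only [Set.Finite.mem_toFinset, Set.mem_ofPred_eq] at hk
        obtain ⟨s0, T, hT, hQ⟩ := aux_prog (b k) c r N (hb k) (hc k)
        have h := hQ (fun _ => True)
        simp only [and_true, Finset.filter_true, Finset.card_range] at h
        rw [h]
        have hkR : (b k : ℝ) ≤ N * c + r := by exact_mod_cast hk
        have : 1 ≤ ((N : ℝ) * c + r) * (1 / b k) := by
          rw [mul_one_div, le_div_iff₀ (hbpos k)]; linarith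
        have h2 := (abs_le.1 hT).2
        have h3 : (N : ℝ) / b k = N * (1 / b k) := by ring
        rw [add_mul]
        linarith
    _ = ((N : ℝ) + (N * c + r)) * ∑ k ∈ hfin.toFinset, (1 / (b k : ℝ)) := by
        rw [Finset.mul_sum]
    _ ≤ _ := by
        apply mul_le_mul_of_nonneg_left _ (by positivity)
        exact hsum.sum_le_tsum _ (fun k _ => by positivity)

theorem stmt0 (b : ℕ → ℕ) (hb : ∀ k, 2 ≤ b k)
    (hcop : ∀ i j, i ≠ j → Nat.Coprime (b i) (b j))
    (hsum : Summable (fun k => (1 : ℝ) / b k))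
    (c r : ℕ) (hc : ∀ k, Nat.Coprime c (b k)) :
    Filter.Tendsto
      (fun N : ℕ =>
        (((Finset.Icc 1 N).filter (fun s => ∀ k, ¬ b k ∣ s * c + r)).card : ℝ) / N)
      Filter.atTop (nhds (∏' k, (1 - 1 / (b k : ℝ)))) := by
  have hc0 : 0 < c := by
    rcases Nat.eq_zero_or_pos c with h | h
    · have h1 := hc 0
      have h2 := hb 0
      rw [h, Nat.coprime_zero_left] at h1
      omega
    · exact h
  have hshift : ∀ N, ((Finset.Icc 1 N).filter (fun s => ∀ k, ¬ b k ∣ s * c + r)).card =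
      ((Finset.range N).filter (fun s => ∀ k, ¬ b k ∣ s * c + (c + r))).card := by
    intro N
    symm
    apply Finset.card_bij (fun s _ => s + 1)
    · intro s hs
      simp only [Finset.mem_filter, Finset.mem_range, Finset.mem_Icc] at hs ⊢
      refine ⟨by omega, fun k => ?_⟩
      have : (s + 1) * c + r = s * c + (c + r) := by ring
      rw [this]; exact hs.2 k
    · intro a _ a' _ h
      exact Nat.add_right_cancel h
    · intro s hs
      simp only [Finset.mem_filter, Finset.mem_Icc] at hs
      obtain ⟨t, rfl⟩ : ∃ t, s = t + 1 := ⟨s - 1, by omega⟩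
      refine ⟨t, ?_, rfl⟩
      simp only [Finset.mem_filter, Finset.mem_range]
      refine ⟨by omega, fun k => ?_⟩
      have : (t + 1) * c + r = t * c + (c + r) := by ring
      rw [← this]; exact hs.2 k
  simp_rw [hshift]
  have hr : 0 < c + r := by omega
  generalize c + r = r' at hr
  have hmul : Multipliable (fun k => 1 - 1 / (b k : ℝ)) := by
    have := Real.multipliable_one_add_of_summable (f := fun k => - (1 / (b k : ℝ))) hsum.neg
    simpa [sub_eq_add_neg] using this
  have hP := hmul.hasProd.tendsto_prod_nat
  have hτ := tendsto_sum_nat_add (fun k => (1 : ℝ) / b k)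
  rw [Metric.tendsto_atTop]
  intro ε hε
  have e1 := (Metric.tendsto_nhds.1 hP) (ε / 3) (by positivity)
  have hτ2 := hτ.const_mul ((1 : ℝ) + (c + r'))
  rw [mul_zero] at hτ2
  have e2 := hτ2.eventually_lt_const (u := ε / 3) (by positivity)
  obtain ⟨K, hK1, hK2⟩ := (e1.and e2).exists
  have e3 := (tendsto_const_div_atTop_nhds_zero_nat ((3 : ℝ) ^ K)).eventually_lt_const
    (u := ε / 3) (by positivity)
  obtain ⟨N0, hN0⟩ := Filter.eventually_atTop.1 e3
  refine ⟨max N0 1, fun N hN => ?_⟩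
  have hN1 : 1 ≤ N := (le_max_right _ _).trans hN
  have h3 := hN0 N ((le_max_left _ _).trans hN)
  have hNR : (1 : ℝ) ≤ N := by exact_mod_cast hN1
  have hN' : (0 : ℝ) < N := by linarith
  have hfin := aux_fin b hb hcop K c r' N (fun k => Or.inr (hc k))
  have htail := aux_tail (fun k => b (k + K)) (fun k => hb _)
    ((summable_nat_add_iff (f := fun k => (1 : ℝ) / b k) K).2 hsum) c r' hr (fun k => hc _) N
  have hle : ((Finset.range N).filter (fun s => ∀ k, ¬ b k ∣ s * c + r')).card ≤
      ((Finset.range N).filter (fun s => ∀ k < K, ¬ b k ∣ s * c + r')).card := by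
    apply Finset.card_le_card
    intro s hs
    simp only [Finset.mem_filter] at hs ⊢
    exact ⟨hs.1, fun k _ => hs.2 k⟩
  have hge : ((Finset.range N).filter (fun s => ∀ k < K, ¬ b k ∣ s * c + r')).card ≤
      ((Finset.range N).filter (fun s => ∀ k, ¬ b k ∣ s * c + r')).card +
      ((Finset.range N).filter (fun s => ∃ k, b (k + K) ∣ s * c + r')).card := by
    refine le_trans (Finset.card_le_card ?_) (Finset.card_union_le _ _)
    intro s hs
    simp only [Finset.mem_filter, Finset.mem_union] at hs ⊢
    by_cases h : ∃ k, b (k + K) ∣ s * c + r'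
    · exact Or.inr ⟨hs.1, h⟩
    · refine Or.inl ⟨hs.1, fun k hk => ?_⟩
      rcases lt_or_ge k K with hkK | hkK
      · exact hs.2 k hkK hk
      · exact h ⟨k - K, by rwa [Nat.sub_add_cancel hkK]⟩
  have hleR : (_ : ℝ) ≤ _ := Nat.cast_le.2 hle
  have hgeR : (_ : ℝ) ≤ _ := Nat.cast_le.2 hge
  rw [Nat.cast_add] at hgeR
  set F : ℝ := (((Finset.range N).filter (fun s => ∀ k, ¬ b k ∣ s * c + r')).card : ℝ)
  set FK : ℝ := (((Finset.range N).filter (fun s => ∀ k < K, ¬ b k ∣ s * c + r')).card : ℝ)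
  set P := ∏' k, (1 - 1 / (b k : ℝ))
  set PK := ∏ k ∈ Finset.range K, (1 - 1 / (b k : ℝ))
  set τ := ∑' k, (1 : ℝ) / b (k + K) with hτdef
  have hτ0 : 0 ≤ τ := tsum_nonneg (fun k => by positivity)
  have htail2 : ((N : ℝ) + (N * c + r')) * τ ≤ N * (ε / 3) := by
    have : ((N : ℝ) + (N * c + r')) ≤ N * (1 + (c + r')) := by
      nlinarith [(Nat.cast_nonneg r' : (0 : ℝ) ≤ r')]
    calc _ ≤ (N * (1 + ((c : ℝ) + r'))) * τ := mul_le_mul_of_nonneg_right this hτ0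
      _ = N * ((1 + ((c : ℝ) + r')) * τ) := by ring
      _ ≤ _ := mul_le_mul_of_nonneg_left hK2.le hN'.le
  rw [div_lt_iff₀ hN'] at h3
  rw [Real.dist_eq] at hK1 ⊢
  have hFN : F / N - P = (F - N * P) / N := by field_simp
  rw [hFN, abs_div, abs_of_pos hN', div_lt_iff₀ hN']
  have hPN : |N * PK - N * P| < N * (ε / 3) := by
    rw [← mul_sub, abs_mul, abs_of_pos hN']
    exact mul_lt_mul_of_pos_left hK1 hN'
  rw [abs_lt] at *
  rw [abs_le] at hfin
  constructor <;> linarith [hfin.1, hfin.2, hPN.1, hPN.2]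
end

section
/- Let 𝔅 = {b_k : k ≥ 1} be pairwise coprime integers ≥ 2 with ∑ 1/b_k < ∞, and let η ∈ {0,1}^ℤ be the indicator of the 𝔅-free integers (η(n) = 1 iff no b_k divides n). Then the set of words occurring in η coincides with the set of finite 𝔅-admissible {0,1}-words: a point y ∈ {0,1}^ℤ has all its words occurring in η if and only if for every k, supp(y) mod b_k omits at least one residue class modulo b_k. -/
theorem aux_tail_s11 (f : ℕ → ℝ) (hf : Summable f) (ε : ℝ) (hε : 0 < ε) :
    ∃ N : ℕ, ∀ t : Finset ℕ, (∀ k ∈ t, N ≤ k) → ∑ k ∈ t, f k < ε := by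
  obtain ⟨s, hs⟩ := summable_iff_vanishing_norm.1 hf ε hε
  refine ⟨s.sup id + 1, fun t ht => lt_of_le_of_lt (le_abs_self _) (hs t ?_)⟩
  rw [Finset.disjoint_left]
  intro k hk hks
  have h1 := ht k hk
  have h2 : k ≤ s.sup id := Finset.le_sup (f := id) hks
  omega

theorem aux_count (b P c T : ℕ) (hb : 0 < b) (hP : Nat.Coprime b P) :
    (((Finset.range T).filter (fun t => b ∣ c + P * t)).card : ℝ) ≤ T / b + 1 := by
  have key : ((Finset.range T).filter (fun t => b ∣ c + P * t)).card ≤ T / b + 1 := by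
    rcases Finset.eq_empty_or_nonempty ((Finset.range T).filter (fun t => b ∣ c + P * t)) with h | ⟨t0, h0⟩
    · rw [h]; simp
    · have h0' := (Finset.mem_filter.1 h0).2
      calc _ ≤ ((Finset.range T).filter (fun t => t ≡ t0 [MOD b])).card := by
            apply Finset.card_le_card
            intro t ht
            rw [Finset.mem_filter] at ht ⊢
            refine ⟨ht.1, ?_⟩
            have h3 : c + P * t ≡ c + P * t0 [MOD b] :=
              (Nat.modEq_zero_iff_dvd.2 ht.2).trans (Nat.modEq_zero_iff_dvd.2 h0').symm
            have h4 : P * t ≡ P * t0 [MOD b] := Nat.ModEq.add_left_cancel' c h3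
            exact Nat.ModEq.cancel_left_of_coprime hP h4
        _ ≤ T / b + 1 := by
            rw [← Nat.count_eq_card_filter_range, Nat.count_modEq_card T hb t0]
            split_ifs <;> omega
  have h2 : ((T / b : ℕ) : ℝ) ≤ (T : ℝ) / b := Nat.cast_div_le
  have h3 : (((Finset.range T).filter (fun t => b ∣ c + P * t)).card : ℝ) ≤ ((T / b : ℕ) : ℝ) + 1 := by
    exact_mod_cast key
  linarith

theorem aux_large (b : ℕ → ℕ) (hb : ∀ k, 2 ≤ b k) (hsum : Summable fun k => (1 : ℝ) / b k) (M : ℕ) :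
    ∃ K, ∀ k, K ≤ k → M < b k := by
  obtain ⟨K, hK⟩ := aux_tail_s11 _ hsum (1 / (M + 1)) (by positivity)
  refine ⟨K, fun k hk => ?_⟩
  have h := hK {k} (by simpa using hk)
  rw [Finset.sum_singleton] at h
  have h1 : (0 : ℝ) < b k := by have := hb k; exact_mod_cast (by omega : 0 < b k)
  rw [one_div_lt_one_div h1 (by positivity)] at h
  have : M + 1 < b k := by exact_mod_cast h
  omega

theorem aux_sieve (b : ℕ → ℕ) (hb : ∀ k, 2 ≤ b k) (hsum : Summable fun k => (1 : ℝ) / b k)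
    (m P c N : ℕ) (hc : 0 < c) (hP : ∀ k, N ≤ k → Nat.Coprime (b k) P)
    (hN : ∀ t : Finset ℕ, (∀ k ∈ t, N ≤ k) → ∑ k ∈ t, (1 : ℝ) / b k < 1 / (4 * (m + 1))) :
    ∃ t : ℕ, ∀ k, N ≤ k → ∀ j, j < m → ¬ b k ∣ c + P * t + j := by
  have hbp : ∀ k, (0 : ℝ) < b k := fun k => by
    have := hb k; exact_mod_cast (by omega : 0 < b k)
  set C : ℕ := c + P + m with hC
  have hCpos : (0 : ℝ) < C := by exact_mod_cast (by omega : 0 < C)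
  obtain ⟨N', hN'⟩ := aux_tail_s11 _ hsum (1 / (2 * (m + 1) * C)) (by positivity)
  set T : ℕ := ∑ k ∈ Finset.range N', b k + 1 with hT
  have hTpos : (0 : ℝ) < T := by exact_mod_cast (by omega : 0 < T)
  obtain ⟨K, hK⟩ := aux_large b hb hsum (C * T)
  have hval : ∀ t j, t < T → j < m → c + P * t + j ≤ C * T := by
    intro t j ht hj
    have h1 : 1 ≤ T := by omega
    nlinarith [Nat.mul_le_mul_left P ht.le, Nat.mul_le_mul_left c h1, Nat.mul_le_mul_left m h1]
  by_contra hcon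
  push Not at hcon
  have hcnt : ∀ k, N ≤ k → ∀ j, j < m →
      (((Finset.range T).filter (fun t => b k ∣ (c + j) + P * t)).card : ℝ)
        ≤ 2 * T * (1 / b k) + (if N' ≤ k then C * T * (1 / (b k : ℝ)) else 0) := by
    intro k hk j hj
    have h1 := aux_count (b k) P (c + j) T (by have := hb k; omega) (hP k hk)
    have hTb : (T : ℝ) / b k = T * (1 / b k) := by ring
    have hTbp : 0 < (T : ℝ) * (1 / b k) := mul_pos hTpos (one_div_pos.2 (hbp k))
    split_ifs with hkN
    · by_cases hbig : b k ≤ C * T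
      · have : (1 : ℝ) ≤ C * T * (1 / b k) := by
          rw [mul_one_div, one_le_div (hbp k)]
          exact_mod_cast hbig
        linarith
      · have : (Finset.range T).filter (fun t => b k ∣ (c + j) + P * t) = ∅ := by
          rw [Finset.filter_eq_empty_iff]
          intro t ht hd
          have h2 := hval t j (Finset.mem_range.1 ht) hj
          have h3 := Nat.le_of_dvd (by omega) hd
          omega
        rw [this]
        have := one_div_pos.2 (hbp k)
        simp only [Finset.card_empty, Nat.cast_zero]
        positivity
    · have h2 : b k ≤ T := by
        have := Finset.single_le_sum (f := b) (fun _ _ => Nat.zero_le _)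
          (Finset.mem_range.2 (not_le.1 hkN))
        omega
      have : (1 : ℝ) ≤ T * (1 / b k) := by
        rw [mul_one_div, one_le_div (hbp k)]
        exact_mod_cast h2
      linarith
  have hcover : Finset.range T ⊆ (Finset.range m).biUnion fun j => (Finset.Ico N K).biUnion fun k =>
      (Finset.range T).filter (fun t => b k ∣ (c + j) + P * t) := by
    intro t ht
    obtain ⟨k, hk, j, hj, hd⟩ := hcon t
    simp only [Finset.mem_biUnion, Finset.mem_filter, Finset.mem_range, Finset.mem_Ico]
    refine ⟨j, hj, k, ⟨hk, ?_⟩, Finset.mem_range.1 ht, ?_⟩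
    · by_contra hkK
      have h1 := hK k (not_lt.1 hkK)
      have h2 := hval t j (Finset.mem_range.1 ht) hj
      have h3 := Nat.le_of_dvd (by omega) hd
      omega
    · rwa [add_right_comm] at hd
  have hle : (T : ℝ) ≤ ∑ j ∈ Finset.range m, ∑ k ∈ Finset.Ico N K,
      (((Finset.range T).filter (fun t => b k ∣ (c + j) + P * t)).card : ℝ) := by
    have h1 := Finset.card_le_card hcover
    rw [Finset.card_range] at h1
    have h2 := h1.trans (Finset.card_biUnion_le.trans
      (Finset.sum_le_sum fun j _ => Finset.card_biUnion_le))
    exact_mod_cast h2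
  have hA := hN (Finset.Ico N K) (fun k hk => (Finset.mem_Ico.1 hk).1)
  have hB := hN' ((Finset.Ico N K).filter (fun k => N' ≤ k)) (fun k hk => (Finset.mem_filter.1 hk).2)
  have hin : ∀ j ∈ Finset.range m, ∑ k ∈ Finset.Ico N K,
      (((Finset.range T).filter (fun t => b k ∣ (c + j) + P * t)).card : ℝ) ≤ T / (m + 1) := by
    intro j hj
    calc _ ≤ ∑ k ∈ Finset.Ico N K,
          (2 * T * (1 / (b k : ℝ)) + (if N' ≤ k then C * T * (1 / (b k : ℝ)) else 0)) :=
          Finset.sum_le_sum fun k hk => hcnt k (Finset.mem_Ico.1 hk).1 j (Finset.mem_range.1 hj)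
      _ = 2 * T * ∑ k ∈ Finset.Ico N K, (1 / (b k : ℝ)) +
          C * T * ∑ k ∈ (Finset.Ico N K).filter (fun k => N' ≤ k), (1 / (b k : ℝ)) := by
          rw [Finset.sum_add_distrib, ← Finset.sum_filter, Finset.mul_sum, Finset.mul_sum]
      _ ≤ 2 * T * (1 / (4 * (m + 1))) + C * T * (1 / (2 * (m + 1) * C)) := by gcongr
      _ = T / (m + 1) := by field_simp; ring
  have hfin := hle.trans (Finset.sum_le_sum hin)
  rw [Finset.sum_const, Finset.card_range, nsmul_eq_mul] at hfin
  have : (m : ℝ) * (T / (m + 1)) < T := by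
    rw [← mul_div_assoc, div_lt_iff₀ (by positivity)]
    nlinarith
  linarith

theorem stmt11 (b : ℕ → ℕ) (hb : ∀ k, 2 ≤ b k)
    (hcop : ∀ i j, i ≠ j → Nat.Coprime (b i) (b j))
    (hsum : Summable fun k => (1 : ℝ) / b k)
    (η : ℤ → Bool) (hη : ∀ n : ℤ, η n = true ↔ ∀ k, ¬ ((b k : ℤ) ∣ n)) :
    ∀ y : ℤ → Bool,
      ((∀ (a : ℤ) (m : ℕ), ∃ i : ℤ, ∀ j : ℕ, j < m → y (a + (j : ℤ)) = η (i + (j : ℤ))) ↔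
        (∀ k, ∃ z : ZMod (b k), ∀ m : ℤ, y m = true → (m : ZMod (b k)) ≠ z)) := by
  intro y
  constructor
  · intro h k
    by_contra hcon
    push Not at hcon
    have : NeZero (b k) := ⟨by have := hb k; omega⟩
    choose f hf1 hf2 using hcon
    set M : ℕ := ∑ z, (f z).natAbs with hM
    obtain ⟨i, hi⟩ := h (-(M : ℤ)) (2 * M + 1)
    set z : ZMod (b k) := ((-(M : ℤ) - i : ℤ) : ZMod (b k)) with hz
    have hzM : (f z).natAbs ≤ M :=
      Finset.single_le_sum (f := fun z => (f z).natAbs) (fun _ _ => Nat.zero_le _) (Finset.mem_univ z)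
    have h1 := hi (f z + M).toNat (by omega)
    have h2 : (((f z + M).toNat : ℕ) : ℤ) = f z + M := by omega
    rw [h2, show -(M : ℤ) + (f z + M) = f z by ring, hf1] at h1
    refine (hη _).1 h1.symm k ?_
    rw [← ZMod.intCast_zmod_eq_zero_iff_dvd]
    have h3 : ((f z : ℤ) : ZMod (b k)) = -(M : ZMod (b k)) - (i : ZMod (b k)) := by
      rw [hf2 z, hz]; push_cast; rfl
    push_cast
    linear_combination h3
  · intro h a m
    choose z hz using h
    obtain ⟨N0, hN0⟩ := aux_large b hb hsum m
    obtain ⟨N1, hN1⟩ := aux_tail_s11 _ hsum (1 / (4 * ((m : ℝ) + 1))) (by positivity)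
    set N := max N1 (N0 + m) with hN
    -- residues
    let r : ℕ → ℕ := fun k =>
      if N0 ≤ k ∧ k < N0 + m ∧ y (a + ((k - N0 : ℕ) : ℤ)) = false
      then (-((k - N0 : ℕ) : ZMod (b k))).val else ((a : ZMod (b k)) - z k).val
    obtain ⟨i0, hi0⟩ := Nat.chineseRemainderOfFinset r b (Finset.range N)
      (fun k _ => by have := hb k; omega)
      (fun k _ l _ hkl => hcop k l hkl)
    set P := ∏ k ∈ Finset.range N, b k with hP
    have hPpos : 0 < P := Finset.prod_pos fun k _ => by have := hb k; omega
    obtain ⟨t, ht⟩ := aux_sieve b hb hsum m P (i0 + P) N (by omega)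
      (fun k hk => Nat.Coprime.prod_right fun l hl => hcop k l (by
        have := Finset.mem_range.1 hl; omega))
      (fun s hs => hN1 s fun k hk => (le_max_left _ _).trans (hs k hk))
    have hres : ∀ k, k < N → ((i0 + P + P * t : ℕ) : ZMod (b k)) = (r k : ZMod (b k)) := by
      intro k hk
      have h1 : (i0 : ZMod (b k)) = (r k : ZMod (b k)) :=
        (ZMod.natCast_eq_natCast_iff _ _ _).2 (hi0 k (Finset.mem_range.2 hk))
      have h2 : (P : ZMod (b k)) = 0 :=
        (ZMod.natCast_eq_zero_iff _ _).2 (Finset.dvd_prod_of_mem b (Finset.mem_range.2 hk))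
      push_cast
      rw [h1, h2]; ring
    refine ⟨((i0 + P + P * t : ℕ) : ℤ), fun j hj => ?_⟩
    have hcast : ∀ k, ((b k : ℤ) ∣ ((i0 + P + P * t : ℕ) : ℤ) + (j : ℤ)) ↔
        b k ∣ i0 + P + P * t + j := fun k => by
      rw [← Int.natCast_add, Int.natCast_dvd_natCast]
    cases hy : y (a + j) with
    | true =>
      symm
      rw [hη]
      intro k
      rw [hcast]
      by_cases hk : N ≤ k
      · exact ht k hk j hj
      · intro hd
        have : NeZero (b k) := ⟨by have := hb k; omega⟩
        have h1 := hres k (not_le.1 hk)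
        have h2 := (ZMod.natCast_eq_zero_iff _ _).2 hd
        rw [Nat.cast_add, h1] at h2
        by_cases hc : N0 ≤ k ∧ k < N0 + m ∧ y (a + ((k - N0 : ℕ) : ℤ)) = false
        · simp only [r, if_pos hc, ZMod.natCast_val, ZMod.cast_id', id_eq] at h2
          have h3 : ((j : ℕ) : ZMod (b k)) = ((k - N0 : ℕ) : ZMod (b k)) := by
            linear_combination h2
          rw [ZMod.natCast_eq_natCast_iff] at h3
          have hbk := hN0 k hc.1
          have h4 := Nat.ModEq.eq_of_lt_of_lt h3 (by omega) (by omega)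
          rw [← h4, hy] at hc
          simp at hc
        · simp only [r, if_neg hc, ZMod.natCast_val, ZMod.cast_id', id_eq] at h2
          apply hz k _ hy
          push_cast
          linear_combination h2
    | false =>
      symm
      rw [← Bool.not_eq_true, hη]
      push Not
      refine ⟨N0 + j, ?_⟩
      rw [hcast, ← ZMod.natCast_eq_zero_iff, Nat.cast_add,
        hres (N0 + j) (lt_of_lt_of_le (by omega) (le_max_right _ _))]
      have : NeZero (b (N0 + j)) := ⟨by have := hb (N0 + j); omega⟩
      have hc : N0 ≤ N0 + j ∧ N0 + j < N0 + m ∧ y (a + ((N0 + j - N0 : ℕ) : ℤ)) = false := by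
        refine ⟨by omega, by omega, ?_⟩
        rw [Nat.add_sub_cancel_left]; exact hy
      simp only [r, if_pos hc, ZMod.natCast_val, ZMod.cast_id', id_eq]
      rw [Nat.add_sub_cancel_left]
      ring
end
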